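/- For every t ∈ ℝ, φ(t)² ≤ (2/π) · Φ(t)(1 − Φ(t)), with equality when t = 0. Equivalently, the function t ↦ φ(t)²/(Φ(t)(1 − Φ(t))) is bounded above by its value at 0, which equals 4φ(0)² = 2/π. -/

import Mathlib

/-- The density `φ` of the standard normal distribution `N(0,1)`. -/
noncomputable def stdGaussPDF (t : ℝ) : ℝ := (Real.sqrt (2 * Real.pi))⁻¹ * Real.exp (-t ^ 2 / 2)

/-- The cumulative distribution function `Φ` of the standard normal distribution `N(0,1)`. -/
noncomputable def stdGaussCDF (t : ℝ) : ℝ := ∫ x in Set.Iic t, stdGaussPDF x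

open Set Filter Topology MeasureTheory

lemma stdGaussPDF_eq_gaussianPDFReal : stdGaussPDF = ProbabilityTheory.gaussianPDFReal 0 1 := by
  ext t
  simp [stdGaussPDF, ProbabilityTheory.gaussianPDFReal]

lemma integrable_stdGaussPDF : Integrable stdGaussPDF := by
  rw [stdGaussPDF_eq_gaussianPDFReal]
  exact ProbabilityTheory.integrable_gaussianPDFReal 0 1

lemma integral_stdGaussPDF : ∫ x, stdGaussPDF x = 1 := by
  rw [stdGaussPDF_eq_gaussianPDFReal]
  exact ProbabilityTheory.integral_gaussianPDFReal_eq_one 0 one_ne_zero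

lemma stdGaussPDF_pos (t : ℝ) : 0 < stdGaussPDF t := by
  unfold stdGaussPDF
  positivity

lemma stdGaussPDF_neg (t : ℝ) : stdGaussPDF (-t) = stdGaussPDF t := by
  simp [stdGaussPDF]

lemma stdGaussPDF_zero_sq : stdGaussPDF 0 ^ 2 = (2 * Real.pi)⁻¹ := by
  have h : (0 : ℝ) ≤ 2 * Real.pi := by positivity
  simp only [stdGaussPDF, mul_pow, inv_pow, Real.sq_sqrt h]
  simp

lemma hasDerivAt_stdGaussPDF (t : ℝ) : HasDerivAt stdGaussPDF (-t * stdGaussPDF t) t := by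
  have h : HasDerivAt (fun x : ℝ => -x ^ 2 / 2) (-t) t := by
    refine ((hasDerivAt_pow 2 t).neg.div_const 2).congr_deriv ?_
    norm_num
    ring
  refine (h.exp.const_mul (Real.sqrt (2 * Real.pi))⁻¹).congr_deriv ?_
  unfold stdGaussPDF
  ring

lemma continuous_stdGaussPDF : Continuous stdGaussPDF :=
  continuous_iff_continuousAt.2 fun t => (hasDerivAt_stdGaussPDF t).continuousAt

lemma tendsto_stdGaussPDF_atTop : Tendsto stdGaussPDF atTop (𝓝 0) := by
  have h : Tendsto (fun x : ℝ => -x ^ 2 / 2) atTop atBot := by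
    have h2 : Tendsto (fun x : ℝ => x ^ 2 / 2) atTop atTop :=
      (tendsto_pow_atTop two_ne_zero).atTop_div_const two_pos
    simpa only [neg_div, Function.comp_def] using tendsto_neg_atTop_atBot.comp h2
  have h3 := (Real.tendsto_exp_atBot.comp h).const_mul (Real.sqrt (2 * Real.pi))⁻¹
  rwa [mul_zero] at h3

lemma hasDerivAt_stdGaussCDF (t : ℝ) : HasDerivAt stdGaussCDF (stdGaussPDF t) t := by
  have h : stdGaussCDF = fun x => stdGaussCDF 0 + ∫ y in (0 : ℝ)..x, stdGaussPDF y := by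
    ext x
    have := intervalIntegral.integral_Iic_sub_Iic (a := 0) (b := x)
      integrable_stdGaussPDF.integrableOn integrable_stdGaussPDF.integrableOn
    simp only [stdGaussCDF]
    linarith
  rw [h]
  exact (continuous_stdGaussPDF.integral_hasStrictDerivAt 0 t).hasDerivAt.const_add _

lemma tendsto_stdGaussCDF_atTop : Tendsto stdGaussCDF atTop (𝓝 1) := by
  rw [← integral_stdGaussPDF]
  exact (aecover_Iic tendsto_id).integral_tendsto_of_countably_generated integrable_stdGaussPDF

lemma stdGaussCDF_neg (t : ℝ) : stdGaussCDF (-t) = 1 - stdGaussCDF t := by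
  have h := intervalIntegral.integral_Iic_add_Ioi (b := t)
    integrable_stdGaussPDF.integrableOn integrable_stdGaussPDF.integrableOn
  have h2 := integral_comp_neg_Iic (-t) stdGaussPDF
  simp only [stdGaussPDF_neg, neg_neg] at h2
  rw [integral_stdGaussPDF] at h
  simp only [stdGaussCDF]
  linarith

lemma stdGaussCDF_zero : stdGaussCDF 0 = 1 / 2 := by
  have h := stdGaussCDF_neg 0
  rw [neg_zero] at h
  linarith

/-- The gap `Φ(1 - Φ) - (π/2) φ²` between the two sides of the bound. -/
noncomputable def fisherGap (t : ℝ) : ℝ :=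
  stdGaussCDF t * (1 - stdGaussCDF t) - Real.pi / 2 * stdGaussPDF t ^ 2

/-- The derivative of `fisherGap` divided by `φ`. -/
noncomputable def fisherGapSlope (t : ℝ) : ℝ :=
  1 - 2 * stdGaussCDF t + Real.pi * t * stdGaussPDF t

lemma hasDerivAt_fisherGap (t : ℝ) :
    HasDerivAt fisherGap (stdGaussPDF t * fisherGapSlope t) t := by
  have h := ((hasDerivAt_stdGaussCDF t).mul ((hasDerivAt_stdGaussCDF t).const_sub 1)).sub
    (((hasDerivAt_stdGaussPDF t).pow 2).const_mul (Real.pi / 2))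
  refine h.congr_deriv ?_
  simp only [fisherGapSlope]
  push_cast
  ring

lemma hasDerivAt_fisherGapSlope (t : ℝ) :
    HasDerivAt fisherGapSlope (stdGaussPDF t * (Real.pi - 2 - Real.pi * t ^ 2)) t := by
  have h := (((hasDerivAt_stdGaussCDF t).const_mul 2).const_sub 1).add
    (((hasDerivAt_id t).const_mul Real.pi).mul (hasDerivAt_stdGaussPDF t))
  refine h.congr_deriv ?_
  simp only [id]
  ring

lemma continuous_fisherGap : Continuous fisherGap :=
  continuous_iff_continuousAt.2 fun t => (hasDerivAt_fisherGap t).continuousAt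

lemma continuous_fisherGapSlope : Continuous fisherGapSlope :=
  continuous_iff_continuousAt.2 fun t => (hasDerivAt_fisherGapSlope t).continuousAt

lemma fisherGap_zero : fisherGap 0 = 0 := by
  rw [fisherGap, stdGaussCDF_zero, stdGaussPDF_zero_sq]
  field_simp
  norm_num

lemma fisherGapSlope_zero : fisherGapSlope 0 = 0 := by
  simp [fisherGapSlope, stdGaussCDF_zero]

lemma tendsto_fisherGap_atTop : Tendsto fisherGap atTop (𝓝 0) := by
  have h := (tendsto_stdGaussCDF_atTop.mul (tendsto_stdGaussCDF_atTop.const_sub 1)).sub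
    ((tendsto_stdGaussPDF_atTop.pow 2).const_mul (Real.pi / 2))
  rwa [sub_self, mul_zero, zero_pow two_ne_zero, mul_zero, sub_zero] at h

/-- On `[0, s]` with `π s² ≤ π - 2` the slope increases from `0`. -/
lemma fisherGapSlope_nonneg {s : ℝ} (hs : 0 ≤ s) (h : Real.pi * s ^ 2 ≤ Real.pi - 2) :
    0 ≤ fisherGapSlope s := by
  have hm : MonotoneOn fisherGapSlope (Icc 0 s) := by
    refine monotoneOn_of_hasDerivWithinAt_nonneg (convex_Icc 0 s)
      continuous_fisherGapSlope.continuousOn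
      (fun x _ => (hasDerivAt_fisherGapSlope x).hasDerivWithinAt) fun x hx => ?_
    rw [interior_Icc] at hx
    have hx2 : x ^ 2 ≤ s ^ 2 := pow_le_pow_left₀ hx.1.le hx.2.le 2
    have := mul_le_mul_of_nonneg_left hx2 Real.pi_pos.le
    exact mul_nonneg (stdGaussPDF_pos x).le (by linarith)
  rw [← fisherGapSlope_zero]
  exact hm (left_mem_Icc.2 hs) (right_mem_Icc.2 hs) hs

lemma antitoneOn_fisherGapSlope {s : ℝ} (hs : 0 ≤ s) (h : Real.pi - 2 ≤ Real.pi * s ^ 2) :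
    AntitoneOn fisherGapSlope (Ici s) := by
  refine antitoneOn_of_hasDerivWithinAt_nonpos (convex_Ici s)
    continuous_fisherGapSlope.continuousOn
    (fun x _ => (hasDerivAt_fisherGapSlope x).hasDerivWithinAt) fun x hx => ?_
  rw [interior_Ici] at hx
  have hx2 : s ^ 2 ≤ x ^ 2 := pow_le_pow_left₀ hs (le_of_lt hx) 2
  have := mul_le_mul_of_nonneg_left hx2 Real.pi_pos.le
  exact mul_nonpos_of_nonneg_of_nonpos (stdGaussPDF_pos x).le (by linarith)

lemma fisherGap_nonneg_of_nonneg {t : ℝ} (ht : 0 ≤ t) : 0 ≤ fisherGap t := by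
  rcases le_or_gt 0 (fisherGapSlope t) with hpos | hneg
  · have hm : MonotoneOn fisherGap (Icc 0 t) := by
      refine monotoneOn_of_hasDerivWithinAt_nonneg (convex_Icc 0 t)
        continuous_fisherGap.continuousOn
        (fun x _ => (hasDerivAt_fisherGap x).hasDerivWithinAt) fun x hx => ?_
      rw [interior_Icc] at hx
      refine mul_nonneg (stdGaussPDF_pos x).le ?_
      rcases le_total (Real.pi * x ^ 2) (Real.pi - 2) with h | h
      · exact fisherGapSlope_nonneg hx.1.le h
      · exact hpos.trans (antitoneOn_fisherGapSlope hx.1.le h self_mem_Ici hx.2.le hx.2.le)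
    rw [← fisherGap_zero]
    exact hm (left_mem_Icc.2 ht) (right_mem_Icc.2 ht) ht
  · have hlt : Real.pi - 2 ≤ Real.pi * t ^ 2 := by
      by_contra! h
      exact hneg.not_ge (fisherGapSlope_nonneg ht h.le)
    have ha : AntitoneOn fisherGap (Ici t) := by
      refine antitoneOn_of_hasDerivWithinAt_nonpos (convex_Ici t)
        continuous_fisherGap.continuousOn
        (fun x _ => (hasDerivAt_fisherGap x).hasDerivWithinAt) fun x hx => ?_
      rw [interior_Ici] at hx
      exact mul_nonpos_of_nonneg_of_nonpos (stdGaussPDF_pos x).le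
        ((antitoneOn_fisherGapSlope ht hlt self_mem_Ici (mem_Ici.2 (le_of_lt hx)) (le_of_lt hx)).trans hneg.le)
    refine le_of_tendsto tendsto_fisherGap_atTop ?_
    filter_upwards [eventually_ge_atTop t] with x hx
    exact ha self_mem_Ici hx hx

lemma fisherGap_neg (t : ℝ) : fisherGap (-t) = fisherGap t := by
  rw [fisherGap, fisherGap, stdGaussCDF_neg, stdGaussPDF_neg]
  ring

lemma fisherGap_nonneg (t : ℝ) : 0 ≤ fisherGap t := by
  rcases le_total 0 t with h | h
  · exact fisherGap_nonneg_of_nonneg h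
  · rw [← fisherGap_neg]
    exact fisherGap_nonneg_of_nonneg (neg_nonneg.2 h)

/-- For every `t ∈ ℝ`, `φ(t)² ≤ (2/π) · Φ(t)(1 − Φ(t))`, with equality at `t = 0`;
moreover the bound `2/π` equals `4φ(0)²`. -/
theorem stdGaussPDF_sq_le_fisher_bound :
    (∀ t : ℝ, stdGaussPDF t ^ 2 ≤ 2 / Real.pi * (stdGaussCDF t * (1 - stdGaussCDF t))) ∧
    stdGaussPDF 0 ^ 2 = 2 / Real.pi * (stdGaussCDF 0 * (1 - stdGaussCDF 0)) ∧
    4 * stdGaussPDF 0 ^ 2 = 2 / Real.pi := by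
  refine ⟨fun t => ?_, ?_, ?_⟩
  · have h := mul_nonneg (div_pos two_pos Real.pi_pos).le (fisherGap_nonneg t)
    have e : 2 / Real.pi * (Real.pi / 2 * stdGaussPDF t ^ 2) = stdGaussPDF t ^ 2 := by
      field_simp
    rw [fisherGap, mul_sub, e] at h
    linarith
  · rw [stdGaussPDF_zero_sq, stdGaussCDF_zero]
    field_simp
    norm_num
  · rw [stdGaussPDF_zero_sq]
    field_simp
    norm_num
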